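/- (KP-hierarchy bilinear identities for the bright Gram tau functions.) Let M ≥ 1, N ≥ 1 and let p_i, p̄_i, ξ_{i,0}, ξ̄_{i,0}, q_i^{(k)}, q̄_i^{(k)}, C̃_i^{(k)}, C̄_i^{(k)} ∈ ℂ (1 ≤ i ≤ N, 1 ≤ k ≤ M) with p_i + p̄_j ≠ 0 and q_i^{(k)} + q̄_j^{(k)} ≠ 0 for all i,j,k. On variables (x₁,x₂,x₃,y₁^{(1)},…,y₁^{(M)}) ∈ ℝ^{3+M}, set ξ_i = p_ix₁ + p_i²x₂ + p_i³x₃ + ξ_{i,0}, ξ̄_j = p̄_jx₁ − p̄_j²x₂ + p̄_j³x₃ + ξ̄_{j,0}, η_i^{(k)} = q_i^{(k)}y₁^{(k)}, η̄_i^{(k)} = q̄_i^{(k)}y₁^{(k)}. Define the N×N matrix 𝑀 with entries m_{ij} = e^{ξ_i+ξ̄_j}/(p_i+p̄_j) + Σ_{n=1}^{M} C̃_i^{(n)}C̄_j^{(n)}e^{η_i^{(n)}+η̄_j^{(n)}}/(q_i^{(n)}+q̄_j^{(n)}); f = det 𝑀; g_k = bordered determinant of 𝑀 with column Φ = (e^{ξ_1},…,e^{ξ_N})ᵀ,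 row −(C̄_1^{(k)}e^{η̄_1^{(k)}},…,C̄_N^{(k)}e^{η̄_N^{(k)}}), corner 0; ḡ_k = bordered determinant of 𝑀 with column (C̃_1^{(k)}e^{η_1^{(k)}},…,C̃_N^{(k)}e^{η_N^{(k)}})ᵀ, row −(e^{ξ̄_1},…,e^{ξ̄_N}), corner 0; s_{kl} = determinant of the (N+2)×(N+2) matrix with upper-left block 𝑀, extra columns Φ and ∂_{x₁}Φ, extra rows −(C̄_1^{(l)}e^{η̄_1^{(l)}},…,C̄_N^{(l)}e^{η̄_N^{(l)}}) and −(C̄_1^{(k)}e^{η̄_1^{(k)}},…,C̄_N^{(k)}e^{η̄_N^{(k)}}), and zero 2×2 lower-right block. Then for all k,l ∈ {1,…,M}: (D_{x₁}³ + 3D_{x₁}D_{x₂} − 4D_{x₃})g_k·f = 0; D_{y₁^{(k)}}D_{x₁}f·f = −2g_kḡ_k; D_{x₁}g_k·g_l = s_{kl}f; and D_{y₁^{(l)}}(D_{x₁}² − D_{x₂})g_k·f = −4s_{kl}ḡ_l. -/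

import Mathlib

open Complex

noncomputable section

/-- Partial derivative of a function of `K` real variables in coordinate `j`. -/
def pd {K : ℕ} (j : Fin K) (F : (Fin K → ℝ) → ℂ) : (Fin K → ℝ) → ℂ :=
  fun z => deriv (fun s : ℝ => F (Function.update z j s)) (z j)

/-- Mixed partial derivative `∏_j ∂_{z_j}^{m j}`. -/
def mixedPD {K : ℕ} (m : Fin K → ℕ) (F : (Fin K → ℝ) → ℂ) : (Fin K → ℝ) → ℂ :=
  (List.finRange K).foldr (fun j G => (pd j)^[m j] G) F

/-- The multivariate Hirota bilinear operator `∏_j D_{z_j}^{m j} a·b`. -/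
def Hirota {K : ℕ} (m : Fin K → ℕ) (a b : (Fin K → ℝ) → ℂ) (z : Fin K → ℝ) : ℂ :=
  mixedPD m (fun s => a (z + s) * b (z - s)) 0

/-- Bordered determinant matrix: `[[A, Φ], [-Ψᵀ, 0]]`. -/
def border {N : ℕ} (A : Matrix (Fin N) (Fin N) ℂ) (Φ Ψ : Fin N → ℂ) :
    Matrix (Fin (N + 1)) (Fin (N + 1)) ℂ :=
  Matrix.of fun i j =>
    if hi : (i : ℕ) < N then
      if hj : (j : ℕ) < N then A ⟨i, hi⟩ ⟨j, hj⟩ else Φ ⟨i, hi⟩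
    else if hj : (j : ℕ) < N then -Ψ ⟨j, hj⟩ else 0

/-- Doubly bordered determinant matrix: `[[A, Φ₁, Φ₂], [-Ψ₁ᵀ, 0, 0], [-Ψ₂ᵀ, 0, 0]]`. -/
def border2 {N : ℕ} (A : Matrix (Fin N) (Fin N) ℂ) (Φ₁ Φ₂ Ψ₁ Ψ₂ : Fin N → ℂ) :
    Matrix (Fin (N + 2)) (Fin (N + 2)) ℂ :=
  Matrix.of fun i j =>
    if hi : (i : ℕ) < N then
      if hj : (j : ℕ) < N then A ⟨i, hi⟩ ⟨j, hj⟩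
      else if (j : ℕ) = N then Φ₁ ⟨i, hi⟩ else Φ₂ ⟨i, hi⟩
    else if hj : (j : ℕ) < N then
      if (i : ℕ) = N then -Ψ₁ ⟨j, hj⟩ else -Ψ₂ ⟨j, hj⟩
    else 0

open scoped ContDiff Matrix
open Filter Topology

section PartialDerivatives

variable {K N : ℕ}

/-- `F` has partial derivative `F'` in coordinate `j` at `z`. -/
def HasPDAt (j : Fin K) (F : (Fin K → ℝ) → ℂ) (F' : ℂ) (z : Fin K → ℝ) : Prop :=
  HasDerivAt (fun s : ℝ => F (Function.update z j s)) F' (z j)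

variable {j : Fin K} {F G : (Fin K → ℝ) → ℂ} {F' G' : ℂ} {z : Fin K → ℝ}

lemma HasPDAt.pd_eq (h : HasPDAt j F F' z) : pd j F z = F' := HasDerivAt.deriv h

lemma HasPDAt.mul (hF : HasPDAt j F F' z) (hG : HasPDAt j G G' z) :
    HasPDAt j (fun w => F w * G w) (F' * G z + F z * G') z := by
  have h := HasDerivAt.fun_mul hF hG
  simp only [Function.update_eq_self] at h
  exact h

lemma HasPDAt.add (hF : HasPDAt j F F' z) (hG : HasPDAt j G G' z) :
    HasPDAt j (fun w => F w + G w) (F' + G') z :=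
  HasDerivAt.fun_add hF hG

lemma HasPDAt.sub (hF : HasPDAt j F F' z) (hG : HasPDAt j G G' z) :
    HasPDAt j (fun w => F w - G w) (F' - G') z :=
  HasDerivAt.fun_sub hF hG

lemma HasPDAt.const_mul (c : ℂ) (hF : HasPDAt j F F' z) :
    HasPDAt j (fun w => c * F w) (c * F') z :=
  HasDerivAt.const_mul c hF

lemma HasPDAt.sum {ι : Type*} {s : Finset ι} {F : ι → (Fin K → ℝ) → ℂ} {F' : ι → ℂ}
    (h : ∀ i ∈ s, HasPDAt j (F i) (F' i) z) :
    HasPDAt j (fun w => ∑ i ∈ s, F i w) (∑ i ∈ s, F' i) z :=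
  HasDerivAt.fun_sum h

lemma hasPDAt_fderiv (hF : DifferentiableAt ℝ F z) :
    HasPDAt j F (fderiv ℝ F z (Pi.single j 1)) z := by
  have h1 := hasDerivAt_update z j (z j)
  have h2 : HasFDerivAt F (fderiv ℝ F z) (Function.update z j (z j)) := by
    rw [Function.update_eq_self]; exact hF.hasFDerivAt
  exact h2.comp_hasDerivAt (z j) h1

lemma hasPDAt_pd (hF : DifferentiableAt ℝ F z) : HasPDAt j F (pd j F z) z := by
  rw [(hasPDAt_fderiv hF).pd_eq]; exact hasPDAt_fderiv hF

lemma contDiff_pd_param {E : Type*} [NormedAddCommGroup E] [NormedSpace ℝ E] (j : Fin K)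
    {G : E → (Fin K → ℝ) → ℂ} (hG : ContDiff ℝ ∞ fun x : E × (Fin K → ℝ) => G x.1 x.2) :
    ContDiff ℝ ∞ fun x : E × (Fin K → ℝ) => pd j (G x.1) x.2 := by
  have h : (fun x : E × (Fin K → ℝ) => pd j (G x.1) x.2) = fun x =>
      fderiv ℝ (fun x : E × (Fin K → ℝ) => G x.1 x.2) x (0, Pi.single j 1) := by
    funext x
    apply HasPDAt.pd_eq
    have h2 : HasFDerivAt (fun x : E × (Fin K → ℝ) => G x.1 x.2)
        (fderiv ℝ (fun x : E × (Fin K → ℝ) => G x.1 x.2) x)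
        (x.1, Function.update x.2 j (x.2 j)) := by
      rw [Function.update_eq_self]
      exact (hG.differentiable (by simp) x).hasFDerivAt
    exact h2.comp_hasDerivAt (x.2 j)
      ((hasDerivAt_const (x.2 j) x.1).prodMk (hasDerivAt_update x.2 j (x.2 j)))
  rw [h]
  exact (hG.fderiv_right (by simp)).clm_apply contDiff_const

@[fun_prop]
lemma contDiff_pd (j : Fin K) (hF : ContDiff ℝ ∞ F) : ContDiff ℝ ∞ (pd j F) := by
  have h := contDiff_pd_param (E := ℝ) (G := fun _ => F) j (hF.comp contDiff_snd)
  exact h.comp (contDiff_prodMk_right (0 : ℝ))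

lemma contDiff_mixedPD_param {E : Type*} [NormedAddCommGroup E] [NormedSpace ℝ E]
    (m : Fin K → ℕ) {G : E → (Fin K → ℝ) → ℂ}
    (hG : ContDiff ℝ ∞ fun x : E × (Fin K → ℝ) => G x.1 x.2) :
    ContDiff ℝ ∞ fun x : E × (Fin K → ℝ) => mixedPD m (G x.1) x.2 := by
  unfold mixedPD
  induction List.finRange K with
  | nil => exact hG
  | cons j l ih =>
    simp only [List.foldr_cons]
    induction m j with
    | zero => exact ih
    | succ n ihn =>
      simp only [Function.iterate_succ_apply']
      exact contDiff_pd_param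
        (G := fun e => (pd j)^[n] (l.foldr (fun i H => (pd i)^[m i] H) (G e))) j ihn

lemma continuous_Hirota_param (m : Fin K → ℕ) {a b : ℝ → (Fin K → ℝ) → ℂ}
    (ha : ContDiff ℝ ∞ fun x : ℝ × (Fin K → ℝ) => a x.1 x.2)
    (hb : ContDiff ℝ ∞ fun x : ℝ × (Fin K → ℝ) => b x.1 x.2) (z : Fin K → ℝ) :
    Continuous fun t => Hirota m (a t) (b t) z := by
  have h := contDiff_mixedPD_param (E := ℝ) m
    (G := fun t s => a t (z + s) * b t (z - s)) (by
      have h1 : ContDiff ℝ ∞ fun x : ℝ × (Fin K → ℝ) => (x.1, z + x.2) := by fun_prop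
      have h2 : ContDiff ℝ ∞ fun x : ℝ × (Fin K → ℝ) => (x.1, z - x.2) := by fun_prop
      exact (ha.comp h1).mul (hb.comp h2))
  exact h.continuous.comp (by fun_prop : Continuous fun t : ℝ => (t, (0 : Fin K → ℝ)))

lemma foldr_eq_self {m : Fin K → ℕ} {l : List (Fin K)} (h : ∀ j ∈ l, m j = 0) :
    l.foldr (fun j G => (pd j)^[m j] G) F = F := by
  induction l with
  | nil => rfl
  | cons j l ih =>
    simp only [List.mem_cons, forall_eq_or_imp] at h
    simp [ih h.2, h.1]

lemma foldr_single {m : Fin K → ℕ} {l : List (Fin K)} (hl : l.Nodup) {i : Fin K} (hi : i ∈ l)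
    (h : ∀ j ∈ l, j ≠ i → m j = 0) :
    l.foldr (fun j G => (pd j)^[m j] G) F = (pd i)^[m i] F := by
  induction l with
  | nil => simp at hi
  | cons j l ih =>
    rw [List.nodup_cons] at hl
    by_cases hij : i = j
    · subst hij
      rw [List.foldr_cons, foldr_eq_self]
      intro j hj
      exact h j (List.mem_cons_of_mem _ hj) (fun e => hl.1 (e ▸ hj))
    · have hi' : i ∈ l := by simpa [hij] using hi
      rw [List.foldr_cons, ih hl.2 hi' (fun j hj => h j (List.mem_cons_of_mem _ hj)),
        h j List.mem_cons_self (Ne.symm hij)]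
      rfl

lemma foldr_pair {m : Fin K → ℕ} {l : List (Fin K)} (hl : l.Pairwise (· < ·)) {i j : Fin K}
    (hij : i < j) (hi : i ∈ l) (hj : j ∈ l) (h : ∀ k ∈ l, k ≠ i → k ≠ j → m k = 0) :
    l.foldr (fun j G => (pd j)^[m j] G) F = (pd i)^[m i] ((pd j)^[m j] F) := by
  induction l with
  | nil => simp at hi
  | cons k l ih =>
    rw [List.pairwise_cons] at hl
    have hnd : l.Nodup := hl.2.imp (fun h => ne_of_lt h)
    by_cases hik : i = k
    · subst hik
      have hj' : j ∈ l := by simpa [hij.ne'] using hj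
      rw [List.foldr_cons, foldr_single hnd hj']
      intro k hk hkj
      exact h k (List.mem_cons_of_mem _ hk) (hl.1 k hk).ne' hkj
    · have hi' : i ∈ l := by simpa [hik] using hi
      have hjk : j ≠ k := ((hl.1 i hi').trans hij).ne'
      have hj' : j ∈ l := by simpa [hjk] using hj
      rw [List.foldr_cons, ih hl.2 hi' hj' (fun k hk => h k (List.mem_cons_of_mem _ hk)),
        h k List.mem_cons_self (Ne.symm hik) hjk.symm]
      rfl

lemma mixedPD_single (i : Fin K) (n : ℕ) : mixedPD (Pi.single i n) F = (pd i)^[n] F := by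
  unfold mixedPD
  rw [foldr_single (List.nodup_finRange K) (List.mem_finRange i)]
  · simp
  · intro j _ hj
    simp [hj]

lemma mixedPD_pair {i j : Fin K} (hij : i < j) (m n : ℕ) :
    mixedPD (Pi.single j n + Pi.single i m) F = (pd i)^[m] ((pd j)^[n] F) := by
  unfold mixedPD
  rw [foldr_pair (List.pairwise_lt_finRange K) hij (List.mem_finRange i) (List.mem_finRange j)]
  · simp [hij.ne, hij.ne']
  · intro k _ hi hj
    simp [hi, hj]

/-- The product of `a` shifted by `s` and `b` shifted by `-s`, as a function of `s`. -/
def shiftMul (z : Fin K → ℝ) (a b : (Fin K → ℝ) → ℂ) (s : Fin K → ℝ) : ℂ :=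
  a (z + s) * b (z - s)

variable {a b : (Fin K → ℝ) → ℂ}

@[fun_prop]
lemma contDiff_shiftMul (z : Fin K → ℝ) (ha : ContDiff ℝ ∞ a) (hb : ContDiff ℝ ∞ b) :
    ContDiff ℝ ∞ (shiftMul z a b) := by
  unfold shiftMul
  fun_prop

lemma pd_shiftMul (j : Fin K) (z : Fin K → ℝ) (ha : ContDiff ℝ ∞ a) (hb : ContDiff ℝ ∞ b) :
    pd j (shiftMul z a b) = shiftMul z (pd j a) b - shiftMul z a (pd j b) := by
  funext s
  apply HasPDAt.pd_eq
  have h1 : HasPDAt j (fun s => a (z + s)) (pd j a (z + s)) s := by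
    have h := hasPDAt_pd (j := j) (ha.differentiable (by simp) (z + s))
    have e : ∀ t, z + Function.update s j t = Function.update (z + s) j (z j + t) := by
      intro t; ext k; by_cases hk : k = j
      · subst hk; simp
      · simp [hk]
    unfold HasPDAt at h ⊢
    simp only [e]
    exact HasDerivAt.comp_const_add (z j) (s j) h
  have h2 : HasPDAt j (fun s => b (z - s)) (-pd j b (z - s)) s := by
    have h := hasPDAt_pd (j := j) (hb.differentiable (by simp) (z - s))
    have e : ∀ t, z - Function.update s j t = Function.update (z - s) j (z j - t) := by
      intro t; ext k; by_cases hk : k = j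
      · subst hk; simp
      · simp [hk]
    unfold HasPDAt at h ⊢
    simp only [e]
    exact HasDerivAt.comp_const_sub (z j) (s j) h
  have h := h1.mul h2
  simp only [Pi.sub_apply, shiftMul]
  rw [mul_neg, ← sub_eq_add_neg] at h
  exact h

@[fun_prop]
lemma contDiff_pi_sub (ha : ContDiff ℝ ∞ a) (hb : ContDiff ℝ ∞ b) : ContDiff ℝ ∞ (a - b) :=
  ha.sub hb

lemma pd_sub (j : Fin K) (ha : ContDiff ℝ ∞ a) (hb : ContDiff ℝ ∞ b) :
    pd j (a - b) = pd j a - pd j b := by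
  funext s
  exact ((hasPDAt_pd (ha.differentiable (by simp) s)).sub
    (hasPDAt_pd (hb.differentiable (by simp) s))).pd_eq

lemma Hirota_single_one (i : Fin K) (ha : ContDiff ℝ ∞ a) (hb : ContDiff ℝ ∞ b) :
    Hirota (Pi.single i 1) a b z = pd i a z * b z - a z * pd i b z := by
  unfold Hirota
  rw [mixedPD_single]
  change pd i (shiftMul z a b) 0 = _
  simp (disch := fun_prop) only [pd_shiftMul, Pi.sub_apply, shiftMul, add_zero, sub_zero]

lemma Hirota_single_three (i : Fin K) (ha : ContDiff ℝ ∞ a) (hb : ContDiff ℝ ∞ b) :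
    Hirota (Pi.single i 3) a b z = pd i (pd i (pd i a)) z * b z
      - 3 * (pd i (pd i a) z * pd i b z) + 3 * (pd i a z * pd i (pd i b) z)
      - a z * pd i (pd i (pd i b)) z := by
  unfold Hirota
  rw [mixedPD_single]
  change pd i (pd i (pd i (shiftMul z a b))) 0 = _
  simp (disch := fun_prop) only [pd_shiftMul, pd_sub, Pi.sub_apply, shiftMul, add_zero, sub_zero]
  ring

lemma Hirota_pair_one_one {i j : Fin K} (hij : i < j) (ha : ContDiff ℝ ∞ a)
    (hb : ContDiff ℝ ∞ b) :
    Hirota (Pi.single j 1 + Pi.single i 1) a b z = pd i (pd j a) z * b z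
      - pd j a z * pd i b z - pd i a z * pd j b z + a z * pd i (pd j b) z := by
  unfold Hirota
  rw [mixedPD_pair hij]
  change pd i (pd j (shiftMul z a b)) 0 = _
  simp (disch := fun_prop) only [pd_shiftMul, pd_sub, Pi.sub_apply, shiftMul, add_zero, sub_zero]
  ring

lemma Hirota_pair_one_two {i j : Fin K} (hij : i < j) (ha : ContDiff ℝ ∞ a)
    (hb : ContDiff ℝ ∞ b) :
    Hirota (Pi.single j 1 + Pi.single i 2) a b z = pd i (pd i (pd j a)) z * b z
      - 2 * (pd i (pd j a) z * pd i b z) + pd j a z * pd i (pd i b) z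
      - pd i (pd i a) z * pd j b z + 2 * (pd i a z * pd i (pd j b) z)
      - a z * pd i (pd i (pd j b)) z := by
  unfold Hirota
  rw [mixedPD_pair hij]
  change pd i (pd i (pd j (shiftMul z a b))) 0 = _
  simp (disch := fun_prop) only [pd_shiftMul, pd_sub, Pi.sub_apply, shiftMul, add_zero, sub_zero]
  ring

lemma pd_eqOn {U : Set (Fin K → ℝ)} (hU : IsOpen U) {H : (Fin K → ℝ) → ℂ} (h : Set.EqOn F G U)
    (hG : ∀ z ∈ U, HasPDAt j G (H z) z) : Set.EqOn (pd j F) H U := by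
  intro z hz
  apply HasPDAt.pd_eq
  refine HasDerivAt.congr_of_eventuallyEq (hG z hz) ?_
  have hc : ContinuousAt (fun s : ℝ => Function.update z j s) (z j) := by fun_prop
  have hm : U ∈ 𝓝 (Function.update z j (z j)) := by
    rw [Function.update_eq_self]; exact hU.mem_nhds hz
  filter_upwards [hc.preimage_mem_nhds hm] with s hs using h hs

end PartialDerivatives

section Brackets

variable {K N : ℕ} {j : Fin K} {z : Fin K → ℝ}

lemma contDiff_det {E : Type*} [NormedAddCommGroup E] [NormedSpace ℝ E] {n : Type*} [Fintype n]
    [DecidableEq n] {A : E → Matrix n n ℂ} (h : ∀ i k, ContDiff ℝ ∞ fun x => A x i k) :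
    ContDiff ℝ ∞ fun x => (A x).det := by
  simp only [Matrix.det_apply']
  exact ContDiff.sum fun σ _ => contDiff_const.mul (contDiff_prod fun i _ => h _ _)

lemma contDiff_det_border {E : Type*} [NormedAddCommGroup E] [NormedSpace ℝ E]
    {A : E → Matrix (Fin N) (Fin N) ℂ} {Φ Ψ : E → Fin N → ℂ}
    (hA : ∀ i k, ContDiff ℝ ∞ fun x => A x i k) (hΦ : ∀ i, ContDiff ℝ ∞ fun x => Φ x i)
    (hΨ : ∀ i, ContDiff ℝ ∞ fun x => Ψ x i) :
    ContDiff ℝ ∞ fun x => (border (A x) (Φ x) (Ψ x)).det := by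
  refine contDiff_det fun i k => ?_
  simp only [border, Matrix.of_apply]
  split_ifs
  · exact hA _ _
  · exact hΦ _
  · exact (hΨ _).neg
  · exact contDiff_const

lemma hasPDAt_det {n : Type*} [Fintype n] [DecidableEq n] {A : (Fin K → ℝ) → Matrix n n ℂ}
    {A' : Matrix n n ℂ} (h : ∀ i k, HasPDAt j (fun w => A w i k) (A' i k) z) :
    HasPDAt j (fun w => (A w).det) ((A z).adjugate * A').trace z := by
  have hd : ∀ σ : Equiv.Perm n, HasPDAt j (fun w => ∏ i, A w (σ i) i)
      (∑ i, (∏ k ∈ Finset.univ.erase i, A z (σ k) k) * A' (σ i) i) z := by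
    intro σ
    have := HasDerivAt.fun_finsetProd (u := Finset.univ) fun i _ => h (σ i) i
    simpa only [HasPDAt, Function.update_eq_self, smul_eq_mul] using this
  have hs := HasPDAt.sum (s := Finset.univ) fun (σ : Equiv.Perm n) _ =>
    (hd σ).const_mul ((Equiv.Perm.sign σ : ℤ) : ℂ)
  simp only [Matrix.det_apply']
  convert hs using 1
  simp only [Finset.mul_sum]
  rw [Finset.sum_comm, Matrix.trace]
  refine Finset.sum_congr rfl fun i _ => ?_
  have e : ((A z).adjugate * A').diag i = ((A z).updateCol i (fun k => A' k i)).det := by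
    rw [← Matrix.cramer_apply, Matrix.cramer_eq_adjugate_mulVec]
    rfl
  rw [e, Matrix.det_apply']
  refine Finset.sum_congr rfl fun σ _ => ?_
  rw [← Finset.prod_erase_mul _ _ (Finset.mem_univ i), Matrix.updateCol_self]
  congr 2
  refine Finset.prod_congr rfl fun k hk => ?_
  rw [Matrix.updateCol_ne (Finset.ne_of_mem_erase hk)]

lemma hasPDAt_det_updateRow {n : Type*} [Fintype n] [DecidableEq n]
    {A : (Fin K → ℝ) → Matrix n n ℂ} {A' : Matrix n n ℂ}
    (h : ∀ i k, HasPDAt j (fun w => A w i k) (A' i k) z) (i : n) (v : n → ℂ) :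
    ∃ d, HasPDAt j (fun w => ((A w).updateRow i v).det) d z := by
  refine ⟨_, hasPDAt_det (A' := A'.updateRow i 0) fun a b => ?_⟩
  by_cases hai : a = i
  · subst hai
    simp only [Matrix.updateRow_self]
    exact hasDerivAt_const _ _
  · simp only [Matrix.updateRow_ne hai]
    exact h a b

lemma hasPDAt_inv {n : Type*} [Fintype n] [DecidableEq n] {A : (Fin K → ℝ) → Matrix n n ℂ}
    {A' : Matrix n n ℂ} (h : ∀ i k, HasPDAt j (fun w => A w i k) (A' i k) z)
    (hz : (A z).det ≠ 0) (i k : n) :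
    HasPDAt j (fun w => (A w)⁻¹ i k) ((-((A z)⁻¹ * A' * (A z)⁻¹)) i k) z := by
  have hdet := hasPDAt_det h
  have hdiff : ∀ i k, ∃ d, HasPDAt j (fun w => (A w)⁻¹ i k) d z := by
    intro i k
    obtain ⟨d, hd⟩ := hasPDAt_det_updateRow h k (Pi.single i 1)
    have h1 : HasPDAt j (fun w => (A w).det⁻¹) _ z := HasDerivAt.fun_inv hdet (by
      simpa only [Function.update_eq_self] using hz)
    simp only [Matrix.inv_def, Matrix.smul_apply, Matrix.adjugate_apply, smul_eq_mul,
      Ring.inverse_eq_inv']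
    exact ⟨_, h1.mul hd⟩
  choose W' hW' using hdiff
  have hne : ∀ᶠ s in 𝓝 (z j), (A (Function.update z j s)).det ≠ 0 := by
    have hc : ContinuousAt (fun s => (A (Function.update z j s)).det) (z j) :=
      HasDerivAt.continuousAt hdet
    exact hc.eventually_ne (by simpa only [Function.update_eq_self] using hz)
  have hprod : Matrix.of W' * A z + (A z)⁻¹ * A' = 0 := by
    ext a b
    have h1 : HasPDAt j (fun w => ((A w)⁻¹ * A w) a b) _ z :=
      HasPDAt.sum (s := Finset.univ) fun c _ => (hW' a c).mul (h c b)
    have h2 : HasPDAt j (fun w => ((A w)⁻¹ * A w) a b) 0 z := by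
      refine HasDerivAt.congr_of_eventuallyEq (hasDerivAt_const _ ((1 : Matrix n n ℂ) a b)) ?_
      filter_upwards [hne] with s hs
      rw [Matrix.nonsing_inv_mul _ (isUnit_iff_ne_zero.mpr hs)]
    have h3 := HasDerivAt.unique h1 h2
    rw [Finset.sum_add_distrib] at h3
    exact h3
  have hu : IsUnit (A z).det := isUnit_iff_ne_zero.mpr hz
  have hW : Matrix.of W' = -((A z)⁻¹ * A' * (A z)⁻¹) := by
    have := congrArg (· * (A z)⁻¹) (eq_neg_of_add_eq_zero_left hprod)
    simpa only [Matrix.mul_assoc, Matrix.mul_nonsing_inv _ hu, Matrix.mul_one, Matrix.neg_mul]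
      using this
  rw [← hW]
  exact hW' i k

/-- The function `z ↦ Ψ(z)ᵀ A(z)⁻¹ Φ(z)`. -/
def bracket (A : (Fin K → ℝ) → Matrix (Fin N) (Fin N) ℂ) (Ψ Φ : (Fin K → ℝ) → Fin N → ℂ)
    (z : Fin K → ℝ) : ℂ :=
  Ψ z ⬝ᵥ ((A z)⁻¹ *ᵥ Φ z)

/-- Entrywise partial derivatives of a vector-valued function. -/
def HasVecPDAt (j : Fin K) (Φ : (Fin K → ℝ) → Fin N → ℂ) (Φ' : Fin N → ℂ) (z : Fin K → ℝ) :
    Prop :=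
  ∀ i, HasPDAt j (fun w => Φ w i) (Φ' i) z

/-- Entrywise partial derivatives of a matrix-valued function. -/
def HasMatPDAt (j : Fin K) (A : (Fin K → ℝ) → Matrix (Fin N) (Fin N) ℂ)
    (A' : Matrix (Fin N) (Fin N) ℂ) (z : Fin K → ℝ) : Prop :=
  ∀ i k, HasPDAt j (fun w => A w i k) (A' i k) z

variable {A : (Fin K → ℝ) → Matrix (Fin N) (Fin N) ℂ} {A' : Matrix (Fin N) (Fin N) ℂ}
  {Φ Ψ : (Fin K → ℝ) → Fin N → ℂ} {Φ' Ψ' : Fin N → ℂ}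

lemma hasPDAt_bracket (hA : HasMatPDAt j A A' z) (hΨ : HasVecPDAt j Ψ Ψ' z)
    (hΦ : HasVecPDAt j Φ Φ' z) (hz : (A z).det ≠ 0) :
    HasPDAt j (bracket A Ψ Φ) (Ψ' ⬝ᵥ ((A z)⁻¹ *ᵥ Φ z) + Ψ z ⬝ᵥ ((A z)⁻¹ *ᵥ Φ')
      - Ψ z ⬝ᵥ ((A z)⁻¹ *ᵥ (A' *ᵥ ((A z)⁻¹ *ᵥ Φ z)))) z := by
  have h1 : ∀ i, HasPDAt j (fun w => ((A w)⁻¹ *ᵥ Φ w) i)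
      (((-((A z)⁻¹ * A' * (A z)⁻¹)) *ᵥ Φ z + (A z)⁻¹ *ᵥ Φ') i) z := by
    intro i
    have := HasPDAt.sum (s := Finset.univ) fun k _ => (hasPDAt_inv hA hz i k).mul (hΦ k)
    rw [Finset.sum_add_distrib] at this
    exact this
  have h2 := HasPDAt.sum (s := Finset.univ) fun i _ => (hΨ i).mul (h1 i)
  rw [Finset.sum_add_distrib] at h2
  change HasPDAt j (bracket A Ψ Φ) (Ψ' ⬝ᵥ ((A z)⁻¹ *ᵥ Φ z) + Ψ z ⬝ᵥ _) z at h2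
  convert h2 using 1
  simp only [dotProduct_add, Matrix.neg_mulVec, dotProduct_neg, Matrix.mulVec_mulVec,
    Matrix.mul_assoc]
  ring

lemma hasPDAt_det_inv (hA : HasMatPDAt j A A' z) (hz : (A z).det ≠ 0) :
    HasPDAt j (fun w => (A w).det) ((A z).det * ((A z)⁻¹ * A').trace) z := by
  convert hasPDAt_det hA using 1
  rw [Matrix.inv_def, Ring.inverse_eq_inv', Matrix.smul_mul, Matrix.trace_smul, smul_eq_mul,
    mul_inv_cancel_left₀ hz]

lemma det_border (B : Matrix (Fin N) (Fin N) ℂ) (φ ψ : Fin N → ℂ) (hB : B.det ≠ 0) :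
    (border B φ ψ).det = B.det * (ψ ⬝ᵥ (B⁻¹ *ᵥ φ)) := by
  have : Invertible B := B.invertibleOfIsUnitDet (isUnit_iff_ne_zero.mpr hB)
  have e : border B φ ψ = Matrix.reindex finSumFinEquiv finSumFinEquiv
      (Matrix.fromBlocks B (Matrix.of fun i (_ : Fin 1) => φ i)
        (Matrix.of fun (_ : Fin 1) k => -ψ k) 0) := by
    ext i k
    refine Fin.addCases (fun i => ?_) (fun i => ?_) i <;>
    refine Fin.addCases (fun k => ?_) (fun k => ?_) k <;>
    simp [border]
  rw [e, Matrix.det_reindex_self, Matrix.det_fromBlocks₁₁, Matrix.invOf_eq_nonsing_inv,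
    Matrix.det_fin_one]
  congr 1
  simp [Matrix.mul_apply, dotProduct, Matrix.mulVec, Finset.sum_mul, Finset.mul_sum]
  rw [Finset.sum_comm]
  simp [mul_assoc]

lemma det_border2 (B : Matrix (Fin N) (Fin N) ℂ) (φ₁ φ₂ ψ₁ ψ₂ : Fin N → ℂ) (hB : B.det ≠ 0) :
    (border2 B φ₁ φ₂ ψ₁ ψ₂).det = B.det *
      ((ψ₁ ⬝ᵥ (B⁻¹ *ᵥ φ₁)) * (ψ₂ ⬝ᵥ (B⁻¹ *ᵥ φ₂))
        - (ψ₁ ⬝ᵥ (B⁻¹ *ᵥ φ₂)) * (ψ₂ ⬝ᵥ (B⁻¹ *ᵥ φ₁))) := by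
  have : Invertible B := B.invertibleOfIsUnitDet (isUnit_iff_ne_zero.mpr hB)
  have e : border2 B φ₁ φ₂ ψ₁ ψ₂ = Matrix.reindex finSumFinEquiv finSumFinEquiv
      (Matrix.fromBlocks B (Matrix.of fun i (k : Fin 2) => ![φ₁, φ₂] k i)
        (-Matrix.of ![ψ₁, ψ₂]) 0) := by
    ext i k
    refine Fin.addCases (fun i => ?_) (fun i => ?_) i <;>
    refine Fin.addCases (fun k => ?_) (fun k => ?_) k
    · simp [border2]
    · fin_cases k <;> simp [border2]
    · fin_cases i <;> simp [border2]
    · simp [border2]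
  have hm : ∀ a b, (Matrix.of ![ψ₁, ψ₂] * B⁻¹ * Matrix.of fun i (k : Fin 2) => ![φ₁, φ₂] k i) a b
      = ![ψ₁, ψ₂] a ⬝ᵥ (B⁻¹ *ᵥ ![φ₁, φ₂] b) := by
    intro a b
    rw [Matrix.mul_assoc]
    rfl
  rw [e, Matrix.det_reindex_self, Matrix.det_fromBlocks₁₁, Matrix.invOf_eq_nonsing_inv,
    Matrix.neg_mul, Matrix.neg_mul, zero_sub, neg_neg, Matrix.det_fin_two, hm, hm, hm, hm]
  rfl

end Brackets

section GramSystem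

variable {K N : ℕ}

/-- A matrix function `A` and vector functions `Φ n`, `Φb n` evolving in the KP variables
`x1`, `x2`, `x3` as Gram-type tau functions do. -/
structure GramSystem (x1 x2 x3 : Fin K) (A : (Fin K → ℝ) → Matrix (Fin N) (Fin N) ℂ)
    (Φ Φb : ℕ → (Fin K → ℝ) → Fin N → ℂ) : Prop where
  mat_x1 : ∀ z, HasMatPDAt x1 A (Matrix.vecMulVec (Φ 0 z) (Φb 0 z)) z
  mat_x2 : ∀ z, HasMatPDAt x2 A
    (Matrix.vecMulVec (Φ 1 z) (Φb 0 z) - Matrix.vecMulVec (Φ 0 z) (Φb 1 z)) z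
  mat_x3 : ∀ z, HasMatPDAt x3 A (Matrix.vecMulVec (Φ 2 z) (Φb 0 z)
    - Matrix.vecMulVec (Φ 1 z) (Φb 1 z) + Matrix.vecMulVec (Φ 0 z) (Φb 2 z)) z
  col_x1 : ∀ n z, HasVecPDAt x1 (Φ n) (Φ (n + 1) z) z
  col_x2 : ∀ n z, HasVecPDAt x2 (Φ n) (Φ (n + 2) z) z
  col_x3 : ∀ n z, HasVecPDAt x3 (Φ n) (Φ (n + 3) z) z
  row_x1 : ∀ n z, HasVecPDAt x1 (Φb n) (Φb (n + 1) z) z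

/-- A vector function independent of the KP variables. -/
structure KPConst (x1 x2 x3 : Fin K) (Ψ : (Fin K → ℝ) → Fin N → ℂ) : Prop where
  x1 : ∀ z, HasVecPDAt x1 Ψ 0 z
  x2 : ∀ z, HasVecPDAt x2 Ψ 0 z
  x3 : ∀ z, HasVecPDAt x3 Ψ 0 z

variable {x1 x2 x3 y : Fin K} {A : (Fin K → ℝ) → Matrix (Fin N) (Fin N) ℂ}
  {Φ Φb : ℕ → (Fin K → ℝ) → Fin N → ℂ} {Ψ Ψl X : (Fin K → ℝ) → Fin N → ℂ} {z : Fin K → ℝ}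

lemma trace_mul_vecMulVec (B : Matrix (Fin N) (Fin N) ℂ) (a b : Fin N → ℂ) :
    (B * Matrix.vecMulVec a b).trace = b ⬝ᵥ (B *ᵥ a) := by
  rw [Matrix.mul_vecMulVec, Matrix.trace_vecMulVec, dotProduct_comm]

namespace GramSystem

lemma det_x1 (S : GramSystem x1 x2 x3 A Φ Φb) (hz : (A z).det ≠ 0) :
    HasPDAt x1 (fun w => (A w).det) ((A z).det * bracket A (Φb 0) (Φ 0) z) z := by
  simpa only [trace_mul_vecMulVec, bracket] using hasPDAt_det_inv (S.mat_x1 z) hz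

lemma det_x2 (S : GramSystem x1 x2 x3 A Φ Φb) (hz : (A z).det ≠ 0) :
    HasPDAt x2 (fun w => (A w).det)
      ((A z).det * (bracket A (Φb 0) (Φ 1) z - bracket A (Φb 1) (Φ 0) z)) z := by
  simpa only [Matrix.mul_sub, Matrix.trace_sub, trace_mul_vecMulVec, bracket] using
    hasPDAt_det_inv (S.mat_x2 z) hz

lemma det_x3 (S : GramSystem x1 x2 x3 A Φ Φb) (hz : (A z).det ≠ 0) :
    HasPDAt x3 (fun w => (A w).det)
      ((A z).det * (bracket A (Φb 0) (Φ 2) z - bracket A (Φb 1) (Φ 1) z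
        + bracket A (Φb 2) (Φ 0) z)) z := by
  simpa only [Matrix.mul_sub, Matrix.mul_add, Matrix.trace_sub, Matrix.trace_add,
    trace_mul_vecMulVec, bracket] using hasPDAt_det_inv (S.mat_x3 z) hz

lemma row_col_x1 (S : GramSystem x1 x2 x3 A Φ Φb) (a b : ℕ) (hz : (A z).det ≠ 0) :
    HasPDAt x1 (bracket A (Φb b) (Φ a)) (bracket A (Φb (b + 1)) (Φ a) z
      + bracket A (Φb b) (Φ (a + 1)) z
      - bracket A (Φb b) (Φ 0) z * bracket A (Φb 0) (Φ a) z) z := by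
  convert hasPDAt_bracket (S.mat_x1 z) (S.row_x1 b z) (S.col_x1 a z) hz using 1
  simp [bracket, -Matrix.mulVec_mulVec, Matrix.vecMulVec_mulVec, Matrix.mulVec_smul]
  ring

lemma const_col_x1 (S : GramSystem x1 x2 x3 A Φ Φb) (hΨ : KPConst x1 x2 x3 Ψ) (a : ℕ)
    (hz : (A z).det ≠ 0) :
    HasPDAt x1 (bracket A Ψ (Φ a)) (bracket A Ψ (Φ (a + 1)) z
      - bracket A Ψ (Φ 0) z * bracket A (Φb 0) (Φ a) z) z := by
  convert hasPDAt_bracket (S.mat_x1 z) (hΨ.x1 z) (S.col_x1 a z) hz using 1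
  simp [bracket, -Matrix.mulVec_mulVec, Matrix.vecMulVec_mulVec, Matrix.mulVec_smul]
  ring

lemma const_col_x2 (S : GramSystem x1 x2 x3 A Φ Φb) (hΨ : KPConst x1 x2 x3 Ψ) (a : ℕ)
    (hz : (A z).det ≠ 0) :
    HasPDAt x2 (bracket A Ψ (Φ a)) (bracket A Ψ (Φ (a + 2)) z
      - bracket A Ψ (Φ 1) z * bracket A (Φb 0) (Φ a) z
      + bracket A Ψ (Φ 0) z * bracket A (Φb 1) (Φ a) z) z := by
  convert hasPDAt_bracket (S.mat_x2 z) (hΨ.x2 z) (S.col_x2 a z) hz using 1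
  simp [bracket, -Matrix.mulVec_mulVec, Matrix.vecMulVec_mulVec, Matrix.mulVec_smul,
    Matrix.sub_mulVec, Matrix.mulVec_sub]
  ring

lemma const_col_x3 (S : GramSystem x1 x2 x3 A Φ Φb) (hΨ : KPConst x1 x2 x3 Ψ) (a : ℕ)
    (hz : (A z).det ≠ 0) :
    HasPDAt x3 (bracket A Ψ (Φ a)) (bracket A Ψ (Φ (a + 3)) z
      - bracket A Ψ (Φ 2) z * bracket A (Φb 0) (Φ a) z
      + bracket A Ψ (Φ 1) z * bracket A (Φb 1) (Φ a) z
      - bracket A Ψ (Φ 0) z * bracket A (Φb 2) (Φ a) z) z := by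
  convert hasPDAt_bracket (S.mat_x3 z) (hΨ.x3 z) (S.col_x3 a z) hz using 1
  simp [bracket, -Matrix.mulVec_mulVec, Matrix.vecMulVec_mulVec, Matrix.mulVec_smul,
    Matrix.sub_mulVec, Matrix.mulVec_sub, Matrix.add_mulVec, Matrix.mulVec_add]
  ring

lemma row_const_x1 (S : GramSystem x1 x2 x3 A Φ Φb) (hX : KPConst x1 x2 x3 X) (b : ℕ)
    (hz : (A z).det ≠ 0) :
    HasPDAt x1 (bracket A (Φb b) X) (bracket A (Φb (b + 1)) X z
      - bracket A (Φb b) (Φ 0) z * bracket A (Φb 0) X z) z := by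
  convert hasPDAt_bracket (S.mat_x1 z) (S.row_x1 b z) (hX.x1 z) hz using 1
  simp [bracket, -Matrix.mulVec_mulVec, Matrix.vecMulVec_mulVec, Matrix.mulVec_smul]
  ring

lemma const_const_x1 (S : GramSystem x1 x2 x3 A Φ Φb) (hΨ : KPConst x1 x2 x3 Ψ)
    (hX : KPConst x1 x2 x3 X) (hz : (A z).det ≠ 0) :
    HasPDAt x1 (bracket A Ψ X) (-(bracket A Ψ (Φ 0) z * bracket A (Φb 0) X z)) z := by
  convert hasPDAt_bracket (S.mat_x1 z) (hΨ.x1 z) (hX.x1 z) hz using 1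
  simp [bracket, -Matrix.mulVec_mulVec, Matrix.vecMulVec_mulVec, Matrix.mulVec_smul]
  ring

lemma const_const_x2 (S : GramSystem x1 x2 x3 A Φ Φb) (hΨ : KPConst x1 x2 x3 Ψ)
    (hX : KPConst x1 x2 x3 X) (hz : (A z).det ≠ 0) :
    HasPDAt x2 (bracket A Ψ X) (bracket A Ψ (Φ 0) z * bracket A (Φb 1) X z
      - bracket A Ψ (Φ 1) z * bracket A (Φb 0) X z) z := by
  convert hasPDAt_bracket (S.mat_x2 z) (hΨ.x2 z) (hX.x2 z) hz using 1
  simp [bracket, -Matrix.mulVec_mulVec, Matrix.vecMulVec_mulVec, Matrix.mulVec_smul,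
    Matrix.sub_mulVec, Matrix.mulVec_sub]
  ring

end GramSystem

lemma det_pd_vecMulVec (hA : HasMatPDAt y A (Matrix.vecMulVec (X z) (Ψl z)) z)
    (hz : (A z).det ≠ 0) :
    HasPDAt y (fun w => (A w).det) ((A z).det * bracket A Ψl X z) z := by
  simpa only [trace_mul_vecMulVec, bracket] using hasPDAt_det_inv hA hz

lemma bracket_pd_vecMulVec {Φ₀ Ψd : (Fin K → ℝ) → Fin N → ℂ}
    (hA : HasMatPDAt y A (Matrix.vecMulVec (X z) (Ψl z)) z)
    (hΨ : HasVecPDAt y Ψ (Ψd z) z) (hΦ : HasVecPDAt y Φ₀ 0 z) (hz : (A z).det ≠ 0) :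
    HasPDAt y (bracket A Ψ Φ₀) (bracket A Ψd Φ₀ z
      - bracket A Ψ X z * bracket A Ψl Φ₀ z) z := by
  convert hasPDAt_bracket hA hΨ hΦ hz using 1
  simp [bracket, -Matrix.mulVec_mulVec, Matrix.vecMulVec_mulVec, Matrix.mulVec_smul]
  ring

lemma isOpen_det_ne_zero (hA : ∀ i k, ContDiff ℝ ∞ fun w => A w i k) :
    IsOpen {z | (A z).det ≠ 0} :=
  isOpen_ne_fun (contDiff_det hA).continuous continuous_const

/-- The bilinear identities of a Gram system at points where its matrix is invertible. -/
theorem GramSystem.bilinear_of_det_ne_zero (S : GramSystem x1 x2 x3 A Φ Φb)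
    (h12 : x1 < x2) (h1y : x1 < y) (h2y : x2 < y)
    (hA : ∀ i k, ContDiff ℝ ∞ fun w => A w i k)
    {f gk gl : (Fin K → ℝ) → ℂ} {Ψd : (Fin K → ℝ) → Fin N → ℂ}
    (hf : f = fun w => (A w).det)
    (hgk : gk = fun w => (border (A w) (Φ 0 w) (Ψ w)).det)
    (hgl : gl = fun w => (border (A w) (Φ 0 w) (Ψl w)).det)
    (hgk' : ContDiff ℝ ∞ gk) (hgl' : ContDiff ℝ ∞ gl)
    (hΨ : KPConst x1 x2 x3 Ψ) (hΨl : KPConst x1 x2 x3 Ψl) (hX : KPConst x1 x2 x3 X)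
    (hΨd : KPConst x1 x2 x3 Ψd)
    (hAy : ∀ w, HasMatPDAt y A (Matrix.vecMulVec (X w) (Ψl w)) w)
    (hΨy : ∀ w, HasVecPDAt y Ψ (Ψd w) w) (hΦy : ∀ w, HasVecPDAt y (Φ 0) 0 w)
    (hz : (A z).det ≠ 0) :
    (Hirota (Pi.single x1 3) gk f z + 3 * Hirota (Pi.single x1 1 + Pi.single x2 1) gk f z
        - 4 * Hirota (Pi.single x3 1) gk f z = 0)
      ∧ (Hirota (Pi.single y 1 + Pi.single x1 1) f f z
        = -2 * gl z * (border (A z) (X z) (Φb 0 z)).det)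
      ∧ (Hirota (Pi.single x1 1) gk gl z
        = (border2 (A z) (Φ 0 z) (Φ 1 z) (Ψl z) (Ψ z)).det * f z)
      ∧ (Hirota (Pi.single y 1 + Pi.single x1 2) gk f z
          - Hirota (Pi.single y 1 + Pi.single x2 1) gk f z
        = -4 * (border2 (A z) (Φ 0 z) (Φ 1 z) (Ψl z) (Ψ z)).det
          * (border (A z) (X z) (Φb 0 z)).det) := by
  have hU := isOpen_det_ne_zero hA
  set U := {z | (A z).det ≠ 0} with hUdef
  have hf' : ContDiff ℝ ∞ f := hf ▸ contDiff_det hA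
  set u : ℕ → ℕ → (Fin K → ℝ) → ℂ := fun a b => bracket A (Φb b) (Φ a) with hu
  set v : ℕ → (Fin K → ℝ) → ℂ := fun a => bracket A Ψ (Φ a) with hv
  set vl : ℕ → (Fin K → ℝ) → ℂ := fun a => bracket A Ψl (Φ a) with hvl
  set vd : ℕ → (Fin K → ℝ) → ℂ := fun a => bracket A Ψd (Φ a) with hvd
  set w : ℕ → (Fin K → ℝ) → ℂ := fun b => bracket A (Φb b) X with hw
  set r : (Fin K → ℝ) → ℂ := bracket A Ψ X with hr
  set rl : (Fin K → ℝ) → ℂ := bracket A Ψl X with hrl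
  have df1 : ∀ z ∈ U, HasPDAt x1 f (f z * u 0 0 z) z := hf ▸ fun z hz => S.det_x1 hz
  have df2 : ∀ z ∈ U, HasPDAt x2 f (f z * (u 1 0 z - u 0 1 z)) z :=
    hf ▸ fun z hz => S.det_x2 hz
  have df3 : ∀ z ∈ U, HasPDAt x3 f (f z * (u 2 0 z - u 1 1 z + u 0 2 z)) z :=
    hf ▸ fun z hz => S.det_x3 hz
  have dfy : ∀ z ∈ U, HasPDAt y f (f z * rl z) z :=
    hf ▸ fun z hz => det_pd_vecMulVec (hAy z) hz
  have du1 : ∀ a b, ∀ z ∈ U, HasPDAt x1 (u a b)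
      (u a (b + 1) z + u (a + 1) b z - u 0 b z * u a 0 z) z :=
    fun a b z hz => S.row_col_x1 a b hz
  have dv1 : ∀ a, ∀ z ∈ U, HasPDAt x1 (v a) (v (a + 1) z - v 0 z * u a 0 z) z :=
    fun a z hz => S.const_col_x1 hΨ a hz
  have dv2 : ∀ a, ∀ z ∈ U, HasPDAt x2 (v a)
      (v (a + 2) z - v 1 z * u a 0 z + v 0 z * u a 1 z) z :=
    fun a z hz => S.const_col_x2 hΨ a hz
  have dv3 : ∀ z ∈ U, HasPDAt x3 (v 0)
      (v 3 z - v 2 z * u 0 0 z + v 1 z * u 0 1 z - v 0 z * u 0 2 z) z :=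
    fun z hz => S.const_col_x3 hΨ 0 hz
  have dvy : ∀ z ∈ U, HasPDAt y (v 0) (vd 0 z - r z * vl 0 z) z :=
    fun z hz => bracket_pd_vecMulVec (hAy z) (hΨy z) (hΦy z) hz
  have dvl1 : ∀ a, ∀ z ∈ U, HasPDAt x1 (vl a) (vl (a + 1) z - vl 0 z * u a 0 z) z :=
    fun a z hz => S.const_col_x1 hΨl a hz
  have dvl2 : ∀ a, ∀ z ∈ U, HasPDAt x2 (vl a)
      (vl (a + 2) z - vl 1 z * u a 0 z + vl 0 z * u a 1 z) z :=
    fun a z hz => S.const_col_x2 hΨl a hz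
  have dvd1 : ∀ a, ∀ z ∈ U, HasPDAt x1 (vd a) (vd (a + 1) z - vd 0 z * u a 0 z) z :=
    fun a z hz => S.const_col_x1 hΨd a hz
  have dvd2 : ∀ a, ∀ z ∈ U, HasPDAt x2 (vd a)
      (vd (a + 2) z - vd 1 z * u a 0 z + vd 0 z * u a 1 z) z :=
    fun a z hz => S.const_col_x2 hΨd a hz
  have dw1 : ∀ b, ∀ z ∈ U, HasPDAt x1 (w b) (w (b + 1) z - u 0 b z * w 0 z) z :=
    fun b z hz => S.row_const_x1 hX b hz
  have dr1 : ∀ z ∈ U, HasPDAt x1 r (-(v 0 z * w 0 z)) z :=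
    fun z hz => S.const_const_x1 hΨ hX hz
  have dr2 : ∀ z ∈ U, HasPDAt x2 r (v 0 z * w 1 z - v 1 z * w 0 z) z :=
    fun z hz => S.const_const_x2 hΨ hX hz
  have drl1 : ∀ z ∈ U, HasPDAt x1 rl (-(vl 0 z * w 0 z)) z :=
    fun z hz => S.const_const_x1 hΨl hX hz
  have drl2 : ∀ z ∈ U, HasPDAt x2 rl (vl 0 z * w 1 z - vl 1 z * w 0 z) z :=
    fun z hz => S.const_const_x2 hΨl hX hz
  have hgkU : Set.EqOn gk (fun z => f z * v 0 z) U := fun z hz => by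
    rw [hgk, hf]; exact det_border _ _ _ hz
  have hglU : Set.EqOn gl (fun z => f z * vl 0 z) U := fun z hz => by
    rw [hgl, hf]; exact det_border _ _ _ hz
  have hgb : (border (A z) (X z) (Φb 0 z)).det = f z * w 0 z := by
    rw [hf]; exact det_border _ _ _ hz
  have hs : (border2 (A z) (Φ 0 z) (Φ 1 z) (Ψl z) (Ψ z)).det
      = f z * (vl 0 z * v 1 z - vl 1 z * v 0 z) := by
    rw [hf]; exact det_border2 _ _ _ _ _ hz
  -- derivatives of `f`
  have f1 : Set.EqOn (pd x1 f) (fun z => f z * u 0 0 z) U :=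
    pd_eqOn hU (fun _ _ => rfl) df1
  have f11 : Set.EqOn (pd x1 (pd x1 f)) (fun z => f z * (u 0 1 z + u 1 0 z)) U :=
    pd_eqOn hU f1 fun z hz => by
      convert (df1 z hz).mul (du1 0 0 z hz) using 1; ring
  have f111 : Set.EqOn (pd x1 (pd x1 (pd x1 f)))
      (fun z => f z * (u 0 2 z + 2 * u 1 1 z + u 2 0 z)) U :=
    pd_eqOn hU f11 fun z hz => by
      convert (df1 z hz).mul ((du1 0 1 z hz).add (du1 1 0 z hz)) using 1; ring
  have f2 : Set.EqOn (pd x2 f) (fun z => f z * (u 1 0 z - u 0 1 z)) U :=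
    pd_eqOn hU (fun _ _ => rfl) df2
  have f12 : Set.EqOn (pd x1 (pd x2 f)) (fun z => f z * (u 2 0 z - u 0 2 z)) U :=
    pd_eqOn hU f2 fun z hz => by
      convert (df1 z hz).mul ((du1 1 0 z hz).sub (du1 0 1 z hz)) using 1; ring
  have f3 : Set.EqOn (pd x3 f) (fun z => f z * (u 2 0 z - u 1 1 z + u 0 2 z)) U :=
    pd_eqOn hU (fun _ _ => rfl) df3
  have fy : Set.EqOn (pd y f) (fun z => f z * rl z) U :=
    pd_eqOn hU (fun _ _ => rfl) dfy
  have f1y : Set.EqOn (pd x1 (pd y f)) (fun z => f z * (rl z * u 0 0 z - vl 0 z * w 0 z)) U :=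
    pd_eqOn hU fy fun z hz => by
      convert (df1 z hz).mul (drl1 z hz) using 1; ring
  have f11y : Set.EqOn (pd x1 (pd x1 (pd y f)))
      (fun z => f z * (rl z * (u 0 1 z + u 1 0 z) - vl 1 z * w 0 z - vl 0 z * w 1 z)) U :=
    pd_eqOn hU f1y fun z hz => by
      convert (df1 z hz).mul (((drl1 z hz).mul (du1 0 0 z hz)).sub
        ((dvl1 0 z hz).mul (dw1 0 z hz))) using 1; ring
  have f2y : Set.EqOn (pd x2 (pd y f))
      (fun z => f z * (rl z * (u 1 0 z - u 0 1 z) + vl 0 z * w 1 z - vl 1 z * w 0 z)) U :=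
    pd_eqOn hU fy fun z hz => by
      convert (df2 z hz).mul (drl2 z hz) using 1; ring
  -- derivatives of the bordered determinants
  have gl1 : Set.EqOn (pd x1 gl) (fun z => f z * vl 1 z) U :=
    pd_eqOn hU hglU fun z hz => by
      convert (df1 z hz).mul (dvl1 0 z hz) using 1; ring
  have g1 : Set.EqOn (pd x1 gk) (fun z => f z * v 1 z) U :=
    pd_eqOn hU hgkU fun z hz => by
      convert (df1 z hz).mul (dv1 0 z hz) using 1; ring
  have g11 : Set.EqOn (pd x1 (pd x1 gk))
      (fun z => f z * (v 2 z + v 1 z * u 0 0 z - v 0 z * u 1 0 z)) U :=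
    pd_eqOn hU g1 fun z hz => by
      convert (df1 z hz).mul (dv1 1 z hz) using 1; ring
  have g111 : Set.EqOn (pd x1 (pd x1 (pd x1 gk)))
      (fun z => f z * (v 3 z + 2 * (v 2 z * u 0 0 z) + v 1 z * u 0 1 z - v 0 z * u 1 1 z
        - 2 * (v 0 z * u 2 0 z))) U :=
    pd_eqOn hU g11 fun z hz => by
      convert (df1 z hz).mul (((dv1 2 z hz).add ((dv1 1 z hz).mul (du1 0 0 z hz))).sub
        ((dv1 0 z hz).mul (du1 1 0 z hz))) using 1; ring
  have g2 : Set.EqOn (pd x2 gk)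
      (fun z => f z * (v 2 z - v 1 z * u 0 0 z + v 0 z * u 1 0 z)) U :=
    pd_eqOn hU hgkU fun z hz => by
      convert (df2 z hz).mul (dv2 0 z hz) using 1; ring
  have g12 : Set.EqOn (pd x1 (pd x2 gk))
      (fun z => f z * (v 3 z - v 1 z * u 0 1 z + v 0 z * u 1 1 z)) U :=
    pd_eqOn hU g2 fun z hz => by
      convert (df1 z hz).mul (((dv1 2 z hz).sub ((dv1 1 z hz).mul (du1 0 0 z hz))).add
        ((dv1 0 z hz).mul (du1 1 0 z hz))) using 1; ring
  have g3 : Set.EqOn (pd x3 gk)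
      (fun z => f z * (v 3 z - v 2 z * u 0 0 z + v 1 z * u 0 1 z + v 0 z * u 2 0 z
        - v 0 z * u 1 1 z)) U :=
    pd_eqOn hU hgkU fun z hz => by
      convert (df3 z hz).mul (dv3 z hz) using 1; ring
  have gy : Set.EqOn (pd y gk) (fun z => f z * (rl z * v 0 z + vd 0 z - r z * vl 0 z)) U :=
    pd_eqOn hU hgkU fun z hz => by
      convert (dfy z hz).mul (dvy z hz) using 1; ring
  have g1y : Set.EqOn (pd x1 (pd y gk))
      (fun z => f z * (rl z * v 1 z + vd 1 z - r z * vl 1 z)) U :=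
    pd_eqOn hU gy fun z hz => by
      convert (df1 z hz).mul ((((drl1 z hz).mul (dv1 0 z hz)).add (dvd1 0 z hz)).sub
        ((dr1 z hz).mul (dvl1 0 z hz))) using 1; ring
  have g11y := pd_eqOn hU g1y fun z hz => (df1 z hz).mul
    ((((drl1 z hz).mul (dv1 1 z hz)).add (dvd1 1 z hz)).sub ((dr1 z hz).mul (dvl1 1 z hz)))
  have g2y := pd_eqOn hU gy fun z hz => (df2 z hz).mul
    ((((drl2 z hz).mul (dv2 0 z hz)).add (dvd2 0 z hz)).sub ((dr2 z hz).mul (dvl2 0 z hz)))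
  have hzU : z ∈ U := hz
  refine ⟨?_, ?_, ?_, ?_⟩
  · rw [add_comm (Pi.single x1 1), Hirota_single_three _ hgk' hf',
      Hirota_pair_one_one h12 hgk' hf', Hirota_single_one _ hgk' hf', hgkU hzU, f1 hzU,
      f11 hzU, f111 hzU, f2 hzU, f12 hzU, f3 hzU, g1 hzU, g11 hzU, g111 hzU, g2 hzU, g12 hzU,
      g3 hzU]
    ring
  · rw [Hirota_pair_one_one h1y hf' hf', hglU hzU, hgb, f1 hzU, fy hzU, f1y hzU]
    ring
  · rw [Hirota_single_one _ hgk' hgl', hs, hgkU hzU, hglU hzU, g1 hzU, gl1 hzU]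
    ring
  · rw [Hirota_pair_one_two h1y hgk' hf', Hirota_pair_one_one h2y hgk' hf', hs, hgb, hgkU hzU,
      f1 hzU, f11 hzU, f2 hzU, fy hzU, f1y hzU, f11y hzU, f2y hzU, g1 hzU, g11 hzU, g2 hzU,
      gy hzU, g1y hzU, g11y hzU, g2y hzU]
    ring

end GramSystem

section Perturbation

variable {K N : ℕ} {x1 x2 x3 y : Fin K} {A : (Fin K → ℝ) → Matrix (Fin N) (Fin N) ℂ}
  {Φ Φb : ℕ → (Fin K → ℝ) → Fin N → ℂ} {Ψ Ψl X : (Fin K → ℝ) → Fin N → ℂ} {z : Fin K → ℝ}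

lemma dense_det_add_smul_one_ne_zero {n : Type*} [Fintype n] [DecidableEq n] (B : Matrix n n ℂ) :
    Dense {t : ℝ | (B + (t : ℂ) • (1 : Matrix n n ℂ)).det ≠ 0} := by
  have hfin : {t : ℝ | (B + (t : ℂ) • (1 : Matrix n n ℂ)).det = 0}.Finite := by
    refine Set.Finite.subset (((-B).charpoly.roots.toFinset.finite_toSet).preimage
      Complex.ofReal_injective.injOn) fun t ht => ?_
    simp only [Set.mem_preimage, Finset.mem_coe, Multiset.mem_toFinset]
    rw [Polynomial.mem_roots (Matrix.charpoly_monic _).ne_zero, Polynomial.IsRoot,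
      Matrix.eval_charpoly, sub_neg_eq_add, add_comm, ← ht, Matrix.smul_one_eq_diagonal]
    rfl
  exact hfin.countable.dense_compl ℝ

lemma HasMatPDAt.add_const {A' : Matrix (Fin N) (Fin N) ℂ} (h : HasMatPDAt y A A' z)
    (B : Matrix (Fin N) (Fin N) ℂ) : HasMatPDAt y (fun w => A w + B) A' z :=
  fun i k => HasDerivAt.add_const (B i k) (h i k)

lemma GramSystem.add_const (S : GramSystem x1 x2 x3 A Φ Φb) (B : Matrix (Fin N) (Fin N) ℂ) :
    GramSystem x1 x2 x3 (fun w => A w + B) Φ Φb where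
  mat_x1 z := (S.mat_x1 z).add_const B
  mat_x2 z := (S.mat_x2 z).add_const B
  mat_x3 z := (S.mat_x3 z).add_const B
  col_x1 := S.col_x1
  col_x2 := S.col_x2
  col_x3 := S.col_x3
  row_x1 := S.row_x1

lemma contDiff_add_smul_one (hA : ∀ i k, ContDiff ℝ ∞ fun w => A w i k) (i k : Fin N) :
    ContDiff ℝ ∞ fun x : ℝ × (Fin K → ℝ) =>
      (A x.2 + (x.1 : ℂ) • (1 : Matrix (Fin N) (Fin N) ℂ)) i k := by
  have h1 : ContDiff ℝ ∞ fun x : ℝ × (Fin K → ℝ) => (x.1 : ℂ) :=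
    Complex.ofRealCLM.contDiff.comp contDiff_fst
  exact ((hA i k).comp contDiff_snd).add (h1.mul contDiff_const)

/-- The bilinear identities of a Gram system. -/
theorem GramSystem.bilinear (S : GramSystem x1 x2 x3 A Φ Φb)
    (h12 : x1 < x2) (h1y : x1 < y) (h2y : x2 < y)
    (hA : ∀ i k, ContDiff ℝ ∞ fun w => A w i k)
    {f gk gl : (Fin K → ℝ) → ℂ} {Ψd : (Fin K → ℝ) → Fin N → ℂ}
    (hf : f = fun w => (A w).det)
    (hgk : gk = fun w => (border (A w) (Φ 0 w) (Ψ w)).det)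
    (hgl : gl = fun w => (border (A w) (Φ 0 w) (Ψl w)).det)
    (hΦc : ∀ i, ContDiff ℝ ∞ fun w => Φ 0 w i) (hΨc : ∀ i, ContDiff ℝ ∞ fun w => Ψ w i)
    (hΨlc : ∀ i, ContDiff ℝ ∞ fun w => Ψl w i)
    (hΨ : KPConst x1 x2 x3 Ψ) (hΨl : KPConst x1 x2 x3 Ψl) (hX : KPConst x1 x2 x3 X)
    (hΨd : KPConst x1 x2 x3 Ψd)
    (hAy : ∀ w, HasMatPDAt y A (Matrix.vecMulVec (X w) (Ψl w)) w)
    (hΨy : ∀ w, HasVecPDAt y Ψ (Ψd w) w) (hΦy : ∀ w, HasVecPDAt y (Φ 0) 0 w)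
    (z : Fin K → ℝ) :
    (Hirota (Pi.single x1 3) gk f z + 3 * Hirota (Pi.single x1 1 + Pi.single x2 1) gk f z
        - 4 * Hirota (Pi.single x3 1) gk f z = 0)
      ∧ (Hirota (Pi.single y 1 + Pi.single x1 1) f f z
        = -2 * gl z * (border (A z) (X z) (Φb 0 z)).det)
      ∧ (Hirota (Pi.single x1 1) gk gl z
        = (border2 (A z) (Φ 0 z) (Φ 1 z) (Ψl z) (Ψ z)).det * f z)
      ∧ (Hirota (Pi.single y 1 + Pi.single x1 2) gk f z
          - Hirota (Pi.single y 1 + Pi.single x2 1) gk f z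
        = -4 * (border2 (A z) (Φ 0 z) (Φ 1 z) (Ψl z) (Ψ z)).det
          * (border (A z) (X z) (Φb 0 z)).det) := by
  set At : ℝ → (Fin K → ℝ) → Matrix (Fin N) (Fin N) ℂ := fun t w => A w + (t : ℂ) • 1 with hAt
  have hAtc := contDiff_add_smul_one hA
  have hAt1 : ∀ t i k, ContDiff ℝ ∞ fun w => At t w i k := fun t i k =>
    (hAtc i k).comp (contDiff_prodMk_right t)
  have hAt2 : ∀ i k, ContDiff ℝ ∞ fun t => At t z i k := fun i k =>
    (hAtc i k).comp (contDiff_prodMk_left z)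
  set ft : ℝ → (Fin K → ℝ) → ℂ := fun t w => (At t w).det with hft
  set gkt : ℝ → (Fin K → ℝ) → ℂ := fun t w => (border (At t w) (Φ 0 w) (Ψ w)).det with hgkt
  set glt : ℝ → (Fin K → ℝ) → ℂ := fun t w => (border (At t w) (Φ 0 w) (Ψl w)).det with hglt
  have hftc : ContDiff ℝ ∞ fun x : ℝ × (Fin K → ℝ) => ft x.1 x.2 := contDiff_det hAtc
  have hgktc : ContDiff ℝ ∞ fun x : ℝ × (Fin K → ℝ) => gkt x.1 x.2 :=
    contDiff_det_border hAtc (fun i => (hΦc i).comp contDiff_snd)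
      fun i => (hΨc i).comp contDiff_snd
  have hgltc : ContDiff ℝ ∞ fun x : ℝ × (Fin K → ℝ) => glt x.1 x.2 :=
    contDiff_det_border hAtc (fun i => (hΦc i).comp contDiff_snd)
      fun i => (hΨlc i).comp contDiff_snd
  have hfz : Continuous fun t => ft t z := (contDiff_det hAt2).continuous
  have hglz : Continuous fun t => glt t z :=
    (contDiff_det_border (Φ := fun _ => Φ 0 z) (Ψ := fun _ => Ψl z) hAt2
      (fun _ => contDiff_const) fun _ => contDiff_const).continuous
  have hgbz : Continuous fun t => (border (At t z) (X z) (Φb 0 z)).det :=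
    (contDiff_det_border (Φ := fun _ => X z) (Ψ := fun _ => Φb 0 z) hAt2
      (fun _ => contDiff_const) fun _ => contDiff_const).continuous
  have hsz : Continuous fun t => (border2 (At t z) (Φ 0 z) (Φ 1 z) (Ψl z) (Ψ z)).det := by
    refine (contDiff_det fun i k => ?_).continuous
    simp only [border2, Matrix.of_apply]
    split_ifs
    · exact hAt2 _ _
    all_goals exact contDiff_const
  have hdense := dense_det_add_smul_one_ne_zero (A z)
  have key := fun t (ht : (At t z).det ≠ 0) =>
    (S.add_const ((t : ℂ) • 1)).bilinear_of_det_ne_zero (z := z) h12 h1y h2y (hAt1 t)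
      (f := ft t) (gk := gkt t) (gl := glt t) rfl rfl rfl
      (hgktc.comp (contDiff_prodMk_right t)) (hgltc.comp (contDiff_prodMk_right t))
      hΨ hΨl hX hΨd (fun w => (hAy w).add_const _) hΨy hΦy ht
  have hA0 : At 0 = A := by funext w; simp [hAt]
  have hf0 : ft 0 = f := by rw [hf, hft]; simp only [hA0]
  have hgk0 : gkt 0 = gk := by rw [hgk, hgkt]; simp only [hA0]
  have hgl0 : glt 0 = gl := by rw [hgl, hglt]; simp only [hA0]
  have hH := fun m {a b} ha hb => continuous_Hirota_param (K := K) m (a := a) (b := b) ha hb z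
  have c1 := Continuous.ext_on hdense
    (((hH _ hgktc hftc).add ((hH _ hgktc hftc).const_mul 3)).sub
      ((hH _ hgktc hftc).const_mul 4)) continuous_const fun t ht => (key t ht).1
  have c2 := Continuous.ext_on hdense (hH _ hftc hftc)
    ((hglz.const_mul (-2)).mul hgbz) fun t ht => (key t ht).2.1
  have c3 := Continuous.ext_on hdense (hH _ hgktc hgltc) (hsz.mul hfz)
    fun t ht => (key t ht).2.2.1
  have c4 := Continuous.ext_on hdense ((hH _ hgktc hftc).sub (hH _ hgktc hftc))
    ((hsz.const_mul (-4)).mul hgbz) fun t ht => (key t ht).2.2.2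
  have e1 := congrFun c1 0
  have e2 := congrFun c2 0
  have e3 := congrFun c3 0
  have e4 := congrFun c4 0
  simp only [Pi.add_apply, Pi.sub_apply, Pi.mul_apply, hA0, hf0, hgk0, hgl0] at e1 e2 e3 e4
  exact ⟨e1, e2, e3, e4⟩

end Perturbation

section Exponentials

variable {K : ℕ} {j : Fin K} {F : (Fin K → ℝ) → ℂ} {F' : ℂ} {z : Fin K → ℝ}

lemma HasPDAt.cexp (hF : HasPDAt j F F' z) :
    HasPDAt j (fun w => Complex.exp (F w)) (F' * Complex.exp (F z)) z := by
  have h := HasDerivAt.cexp hF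
  simp only [Function.update_eq_self] at h
  rw [mul_comm]
  exact h

lemma HasPDAt.div_const (hF : HasPDAt j F F' z) (c : ℂ) :
    HasPDAt j (fun w => F w / c) (F' / c) z :=
  HasDerivAt.div_const hF c

lemma hasPDAt_coord (i : Fin K) :
    HasPDAt j (fun w => (w i : ℂ)) (if i = j then 1 else 0) z := by
  unfold HasPDAt
  split_ifs with h
  · subst h
    simpa using (hasDerivAt_id (z i)).ofReal_comp
  · simpa [Function.update_of_ne h] using hasDerivAt_const (z j) (z i : ℂ)

@[fun_prop]
lemma contDiff_coord (i : Fin K) : ContDiff ℝ ∞ fun w : Fin K → ℝ => (w i : ℂ) :=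
  Complex.ofRealCLM.contDiff.comp (contDiff_apply ℝ ℝ i)

end Exponentials

/-- KP-hierarchy bilinear identities for the bright Gram tau
functions.  The variables are `(x₁, x₂, x₃, y₁⁽¹⁾, …, y₁⁽ᴹ⁾) ∈ ℝ^{M+3}`,
with `x₁, x₂, x₃` the coordinates `0, 1, 2` and `y₁⁽ᵏ⁾` the coordinate `k + 3`. -/
theorem stmt11 (M N : ℕ) (hM : 1 ≤ M) (hN : 1 ≤ N)
    (p pb ξ₀ ξb₀ : Fin N → ℂ) (q qb Ct Cb : Fin N → Fin M → ℂ)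
    (hp : ∀ i j, p i + pb j ≠ 0)
    (hq : ∀ i j k, q i k + qb j k ≠ 0)
    (x1 x2 x3 : Fin (M + 3)) (y : Fin M → Fin (M + 3))
    (hx1 : x1 = ⟨0, by omega⟩) (hx2 : x2 = ⟨1, by omega⟩) (hx3 : x3 = ⟨2, by omega⟩)
    (hy : y = fun k => ⟨(k : ℕ) + 3, by have := k.isLt; omega⟩)
    (ξ ξb : Fin N → (Fin (M + 3) → ℝ) → ℂ)
    (hξ : ξ = fun i z =>
      p i * (z x1 : ℂ) + p i ^ 2 * (z x2 : ℂ) + p i ^ 3 * (z x3 : ℂ) + ξ₀ i)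
    (hξb : ξb = fun j z =>
      pb j * (z x1 : ℂ) - pb j ^ 2 * (z x2 : ℂ) + pb j ^ 3 * (z x3 : ℂ) + ξb₀ j)
    (η ηb : Fin N → Fin M → (Fin (M + 3) → ℝ) → ℂ)
    (hη : η = fun i k z => q i k * (z (y k) : ℂ))
    (hηb : ηb = fun i k z => qb i k * (z (y k) : ℂ))
    (Mmat : (Fin (M + 3) → ℝ) → Matrix (Fin N) (Fin N) ℂ)
    (hMmat : Mmat = fun z => Matrix.of fun i j =>
      Complex.exp (ξ i z + ξb j z) / (p i + pb j)
        + ∑ n, Ct i n * Cb j n * Complex.exp (η i n z + ηb j n z) / (q i n + qb j n))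
    (f : (Fin (M + 3) → ℝ) → ℂ) (hf : f = fun z => (Mmat z).det)
    (g gb : Fin M → (Fin (M + 3) → ℝ) → ℂ)
    (hg : g = fun k z =>
      (border (Mmat z) (fun i => Complex.exp (ξ i z))
        (fun i => Cb i k * Complex.exp (ηb i k z))).det)
    (hgb : gb = fun k z =>
      (border (Mmat z) (fun i => Ct i k * Complex.exp (η i k z))
        (fun i => Complex.exp (ξb i z))).det)
    (s : Fin M → Fin M → (Fin (M + 3) → ℝ) → ℂ)
    (hs : s = fun k l z =>
      (border2 (Mmat z) (fun i => Complex.exp (ξ i z))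
        (fun i => pd x1 (fun w => Complex.exp (ξ i w)) z)
        (fun i => Cb i l * Complex.exp (ηb i l z))
        (fun i => Cb i k * Complex.exp (ηb i k z))).det) :
    ∀ (k l : Fin M) (z : Fin (M + 3) → ℝ),
      (Hirota (Pi.single x1 3) (g k) f z
          + 3 * Hirota (Pi.single x1 1 + Pi.single x2 1) (g k) f z
          - 4 * Hirota (Pi.single x3 1) (g k) f z = 0)
      ∧ (Hirota (Pi.single (y k) 1 + Pi.single x1 1) f f z = -2 * g k z * gb k z)
      ∧ (Hirota (Pi.single x1 1) (g k) (g l) z = s k l z * f z)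
      ∧ (Hirota (Pi.single (y l) 1 + Pi.single x1 2) (g k) f z
          - Hirota (Pi.single (y l) 1 + Pi.single x2 1) (g k) f z
          = -4 * s k l z * gb l z) := by
  intro k l z
  have h12 : x1 < x2 := by simp [hx1, hx2]
  have h13 : x1 < x3 := by simp [hx1, hx3, Fin.lt_def]
  have h23 : x2 < x3 := by simp [hx2, hx3, Fin.lt_def]
  have h3y : ∀ n, x3 < y n := fun n => by simp only [hx3, hy, Fin.lt_def]; omega
  have h2y : ∀ n, x2 < y n := fun n => h23.trans (h3y n)
  have h1y : ∀ n, x1 < y n := fun n => h12.trans (h2y n)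
  have hyinj : ∀ n m, y n = y m ↔ n = m := fun n m => by simp [hy, Fin.ext_iff]
  have dξ : ∀ i j z, HasPDAt j (ξ i) (p i * (if x1 = j then 1 else 0)
      + p i ^ 2 * (if x2 = j then 1 else 0) + p i ^ 3 * (if x3 = j then 1 else 0) + 0) z := by
    intro i j z
    rw [hξ]
    exact ((((hasPDAt_coord x1).const_mul _).add ((hasPDAt_coord x2).const_mul _)).add
      ((hasPDAt_coord x3).const_mul _)).add (hasDerivAt_const _ _)
  have dξb : ∀ i j z, HasPDAt j (ξb i) (pb i * (if x1 = j then 1 else 0)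
      - pb i ^ 2 * (if x2 = j then 1 else 0) + pb i ^ 3 * (if x3 = j then 1 else 0) + 0) z := by
    intro i j z
    rw [hξb]
    exact ((((hasPDAt_coord x1).const_mul _).sub ((hasPDAt_coord x2).const_mul _)).add
      ((hasPDAt_coord x3).const_mul _)).add (hasDerivAt_const _ _)
  have dη : ∀ i n j z, HasPDAt j (η i n) (q i n * (if y n = j then 1 else 0)) z := by
    intro i n j z
    rw [hη]
    exact (hasPDAt_coord (y n)).const_mul _
  have dηb : ∀ i n j z, HasPDAt j (ηb i n) (qb i n * (if y n = j then 1 else 0)) z := by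
    intro i n j z
    rw [hηb]
    exact (hasPDAt_coord (y n)).const_mul _
  have dM : ∀ j z i i', HasPDAt j (fun w => Mmat w i i') _ z := fun j z i i' => by
    rw [hMmat]
    exact (((dξ i j z).add (dξb i' j z)).cexp.div_const (p i + pb i')).add
      (HasPDAt.sum (s := Finset.univ) fun n _ =>
        ((((dη i n j z).add (dηb i' n j z)).cexp.const_mul (Ct i n * Cb i' n)).div_const
          (q i n + qb i' n)))
  have cξ : ∀ i, ContDiff ℝ ∞ (ξ i) := fun i => by rw [hξ]; fun_prop
  have cξb : ∀ i, ContDiff ℝ ∞ (ξb i) := fun i => by rw [hξb]; fun_prop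
  have cη : ∀ i n, ContDiff ℝ ∞ (η i n) := fun i n => by rw [hη]; fun_prop
  have cηb : ∀ i n, ContDiff ℝ ∞ (ηb i n) := fun i n => by rw [hηb]; fun_prop
  have cM : ∀ i i', ContDiff ℝ ∞ fun w => Mmat w i i' := fun i i' => by
    rw [hMmat]
    exact (((cξ i).add (cξb i')).cexp.div_const _).add (ContDiff.sum fun n _ =>
      (contDiff_const.mul ((cη i n).add (cηb i' n)).cexp).div_const _)
  have S : GramSystem x1 x2 x3 Mmat (fun n w i => p i ^ n * Complex.exp (ξ i w))
      (fun n w i => pb i ^ n * Complex.exp (ξb i w)) := by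
    refine ⟨fun z i i' => ?_, fun z i i' => ?_, fun z i i' => ?_, fun n z i => ?_,
      fun n z i => ?_, fun n z i => ?_, fun n z i => ?_⟩
    · convert dM x1 z i i' using 1
      have := hp i i'
      simp [h12.ne', h13.ne', (h1y _).ne', Matrix.vecMulVec_apply, Complex.exp_add]
      field_simp
    · convert dM x2 z i i' using 1
      have := hp i i'
      simp [h12.ne, h23.ne', (h2y _).ne', Matrix.vecMulVec_apply, Complex.exp_add]
      field_simp
      ring
    · convert dM x3 z i i' using 1
      have := hp i i'
      simp [h13.ne, h23.ne, (h3y _).ne', Matrix.vecMulVec_apply, Complex.exp_add]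
      field_simp
      ring
    · convert (dξ i x1 z).cexp.const_mul (p i ^ n) using 1
      simp [h12.ne', h13.ne']
      ring
    · convert (dξ i x2 z).cexp.const_mul (p i ^ n) using 1
      simp [h12.ne, h23.ne']
      ring
    · convert (dξ i x3 z).cexp.const_mul (p i ^ n) using 1
      simp [h13.ne, h23.ne]
      ring
    · convert (dξb i x1 z).cexp.const_mul (pb i ^ n) using 1
      simp [h12.ne', h13.ne']
      ring
  have const_mul_exp_ηb : ∀ (c : Fin N → ℂ) (n : Fin M),
      KPConst x1 x2 x3 (fun w i => c i * Complex.exp (ηb i n w)) := fun c n => by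
    refine ⟨fun z i => ?_, fun z i => ?_, fun z i => ?_⟩
    · simpa [(h1y n).ne'] using (dηb i n x1 z).cexp.const_mul (c i)
    · simpa [(h2y n).ne'] using (dηb i n x2 z).cexp.const_mul (c i)
    · simpa [(h3y n).ne'] using (dηb i n x3 z).cexp.const_mul (c i)
  have const_mul_exp_η : ∀ (c : Fin N → ℂ) (n : Fin M),
      KPConst x1 x2 x3 (fun w i => c i * Complex.exp (η i n w)) := fun c n => by
    refine ⟨fun z i => ?_, fun z i => ?_, fun z i => ?_⟩
    · simpa [(h1y n).ne'] using (dη i n x1 z).cexp.const_mul (c i)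
    · simpa [(h2y n).ne'] using (dη i n x2 z).cexp.const_mul (c i)
    · simpa [(h3y n).ne'] using (dη i n x3 z).cexp.const_mul (c i)
  have hAy : ∀ l z, HasMatPDAt (y l) Mmat
      (Matrix.vecMulVec (fun i => Ct i l * Complex.exp (η i l z))
        (fun i => Cb i l * Complex.exp (ηb i l z))) z := fun l z i i' => by
    convert dM (y l) z i i' using 1
    have h : ∀ n, (q i n * (if y n = y l then 1 else 0) + qb i' n * (if y n = y l then 1 else 0))
        = if n = l then q i n + qb i' n else 0 := fun n => by
      simp only [hyinj]; split_ifs <;> simp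
    simp only [h]
    simp only [(h1y l).ne, (h2y l).ne, (h3y l).ne, Matrix.vecMulVec_apply, Complex.exp_add,
      if_false, mul_zero, zero_mul, add_zero, sub_zero, zero_div, zero_add, ite_mul, mul_ite,
      ite_div, Finset.sum_ite_eq', Finset.mem_univ, if_true]
    have := hq i i' l
    field_simp
  have hΦy : ∀ l z, HasVecPDAt (y l) (fun w i => p i ^ 0 * Complex.exp (ξ i w)) 0 z :=
    fun l z i => by
      convert (dξ i (y l) z).cexp.const_mul (p i ^ 0) using 1
      simp [(h1y l).ne, (h2y l).ne, (h3y l).ne]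
  have hΨy : ∀ k l z, HasVecPDAt (y l) (fun w i => Cb i k * Complex.exp (ηb i k w))
      (fun i => (if k = l then Cb i k * qb i k else 0) * Complex.exp (ηb i k z)) z :=
    fun k l z i => by
      convert (dηb i k (y l) z).cexp.const_mul (Cb i k) using 1
      simp only [hyinj]
      split_ifs <;> simp [mul_assoc]
  have hgk : ∀ k, g k = fun w => (border (Mmat w) (fun i => p i ^ 0 * Complex.exp (ξ i w))
      (fun i => Cb i k * Complex.exp (ηb i k w))).det := fun k => by simp [hg]
  have cΨ : ∀ k i, ContDiff ℝ ∞ fun w => Cb i k * Complex.exp (ηb i k w) := fun k i =>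
    contDiff_const.mul (cηb i k).cexp
  have key := fun k l => S.bilinear h12 (h1y l) (h2y l) cM hf (hgk k) (hgk l)
    (fun i => contDiff_const.mul (cξ i).cexp) (cΨ k) (cΨ l)
    (const_mul_exp_ηb _ k) (const_mul_exp_ηb _ l) (const_mul_exp_η _ l)
    (const_mul_exp_ηb _ k) (hAy l) (hΨy k l) (hΦy l) z
  have hgb' : ∀ k, gb k z = (border (Mmat z) (fun i => Ct i k * Complex.exp (η i k z))
      (fun i => pb i ^ 0 * Complex.exp (ξb i z))).det := fun k => by simp [hgb]
  have hpd : ∀ i, pd x1 (fun w => Complex.exp (ξ i w)) z = p i ^ 1 * Complex.exp (ξ i z) :=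
    fun i => by rw [(dξ i x1 z).cexp.pd_eq]; simp [h12.ne', h13.ne']
  have hs' : s k l z = (border2 (Mmat z) (fun i => p i ^ 0 * Complex.exp (ξ i z))
      (fun i => p i ^ 1 * Complex.exp (ξ i z)) (fun i => Cb i l * Complex.exp (ηb i l z))
      (fun i => Cb i k * Complex.exp (ηb i k z))).det := by
    simp only [hs, hpd, pow_zero, one_mul]
  rw [hs', hgb', hgb']
  exact ⟨(key k l).1, (key k k).2.1, (key k l).2.2.1, (key k l).2.2.2⟩

end
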